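/- Additive linear logic with weakening (ALL W) is not safe for the majority rule: the sequent p, q, ¬(p & q) ⊢ (empty succedent) is derivable in ALL W for distinct atoms p, q, and there exist an agenda Φ of ALL formulas (namely Φ = {p, ¬p, q, ¬q, p&q, ¬(p&q)}), an odd number n ≥ 3 of agents, and a profile of judgment sets over Φ that are complete and robustly consistent in ALL W whose majority outcome contains {p, q, ¬(p&q)} and hence is ALL W-inconsistent. -/

import Mathlib

namespace Stmt14

/-- Formulas of additive linear logic (ALL): atoms, linear negation, & and ⊕, no units. -/
inductive AForm : Type
  | atom  : ℕ → AForm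
  | neg   : AForm → AForm
  | awith : AForm → AForm → AForm         -- &
  | aplus : AForm → AForm → AForm         -- ⊕
  deriving DecidableEq

/-- Sequent calculus for ALL W: the ALL rules plus left and right weakening. -/
inductive AWDeriv : Multiset AForm → Multiset AForm → Prop
  | ax (A) : AWDeriv {A} {A}
  | cut {Γ Δ Γ' Δ' A} : AWDeriv (A ::ₘ Γ) Δ → AWDeriv Γ' (A ::ₘ Δ') →
      AWDeriv (Γ + Γ') (Δ + Δ')
  | negL {Γ Δ A} : AWDeriv Γ (A ::ₘ Δ) → AWDeriv (AForm.neg A ::ₘ Γ) Δ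
  | negR {Γ Δ A} : AWDeriv (A ::ₘ Γ) Δ → AWDeriv Γ (AForm.neg A ::ₘ Δ)
  | withR {Γ Δ A B} : AWDeriv Γ (A ::ₘ Δ) → AWDeriv Γ (B ::ₘ Δ) →
      AWDeriv Γ (AForm.awith A B ::ₘ Δ)
  | withL1 {Γ Δ A B} : AWDeriv (A ::ₘ Γ) Δ → AWDeriv (AForm.awith A B ::ₘ Γ) Δ
  | withL2 {Γ Δ A B} : AWDeriv (B ::ₘ Γ) Δ → AWDeriv (AForm.awith A B ::ₘ Γ) Δ
  | plusL {Γ Δ A B} : AWDeriv (A ::ₘ Γ) Δ → AWDeriv (B ::ₘ Γ) Δ →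
      AWDeriv (AForm.aplus A B ::ₘ Γ) Δ
  | plusR1 {Γ Δ A B} : AWDeriv Γ (A ::ₘ Δ) → AWDeriv Γ (AForm.aplus A B ::ₘ Δ)
  | plusR2 {Γ Δ A B} : AWDeriv Γ (B ::ₘ Δ) → AWDeriv Γ (AForm.aplus A B ::ₘ Δ)
  | weakL {Γ Δ} (A) : AWDeriv Γ Δ → AWDeriv (A ::ₘ Γ) Δ
  | weakR {Γ Δ} (A) : AWDeriv Γ Δ → AWDeriv Γ (A ::ₘ Δ)

/-- ALL W-inconsistency: Γ ⊢ (empty succedent) is derivable in ALL W. -/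
def AWInconsistent (Γ : Multiset AForm) : Prop := AWDeriv Γ 0

/-- Robust consistency in ALL W: every submultiset is ALL W-consistent. -/
def robustlyConsistentW (Γ : Multiset AForm) : Prop :=
  ∀ Δ : Multiset AForm, Δ ≤ Γ → ¬ AWInconsistent Δ

def AForm.compl : AForm → AForm
  | .neg ψ => ψ
  | φ      => .neg φ

def completeOn (Φ J : Finset AForm) : Prop := ∀ φ ∈ Φ, φ ∈ J ∨ φ.compl ∈ J

def nsupp (n : ℕ) (J : Fin n → Finset AForm) (φ : AForm) : ℕ :=
  (Finset.univ.filter (fun i => φ ∈ J i)).card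

def maj (n : ℕ) (Φ : Finset AForm) (J : Fin n → Finset AForm) : Finset AForm :=
  Φ.filter (fun φ => n < 2 * nsupp n J φ)

def p : AForm := .atom 0
def q : AForm := .atom 1

/-- The agenda {p, ¬p, q, ¬q, p&q, ¬(p&q)}. -/
def Φ : Finset AForm := {p, .neg p, q, .neg q, p.awith q, .neg (p.awith q)}

/-- Classical valuation of ALL formulas. -/
def ev (v : ℕ → Bool) : AForm → Bool
  | .atom n => v n
  | .neg A => !(ev v A)
  | .awith A B => ev v A && ev v B
  | .aplus A B => ev v A || ev v B

/-- Classical soundness of ALL W. -/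
theorem sound (v : ℕ → Bool) {Γ Δ : Multiset AForm} (h : AWDeriv Γ Δ) :
    (∀ A ∈ Γ, ev v A = true) → ∃ B ∈ Δ, ev v B = true := by
  induction h with
  | ax A => intro h; exact ⟨A, by simp, h A (by simp)⟩
  | @cut Γ Δ Γ' Δ' A _ _ ih1 ih2 =>
    intro h
    obtain ⟨B, hB, hv⟩ := ih2 (fun C hC => h C (by simp [hC]))
    rcases Multiset.mem_cons.1 hB with rfl | hB
    · obtain ⟨C, hC, hv'⟩ := ih1 (fun C hC => by
        rcases Multiset.mem_cons.1 hC with rfl | hC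
        · exact hv
        · exact h C (by simp [hC]))
      exact ⟨C, by simp [hC], hv'⟩
    · exact ⟨B, by simp [hB], hv⟩
  | negL _ ih =>
    simp only [Multiset.mem_cons, forall_eq_or_imp, exists_eq_or_imp, ev] at *
    grind
  | @negR Γ Δ A _ ih =>
    simp only [Multiset.mem_cons, forall_eq_or_imp, exists_eq_or_imp, ev] at *
    cases h : ev v A <;> grind
  | withR _ _ ih1 ih2 =>
    simp only [Multiset.mem_cons, forall_eq_or_imp, exists_eq_or_imp, ev] at *
    grind
  | withL1 _ ih =>
    simp only [Multiset.mem_cons, forall_eq_or_imp, exists_eq_or_imp, ev] at *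
    grind
  | withL2 _ ih =>
    simp only [Multiset.mem_cons, forall_eq_or_imp, exists_eq_or_imp, ev] at *
    grind
  | plusL _ _ ih1 ih2 =>
    simp only [Multiset.mem_cons, forall_eq_or_imp, exists_eq_or_imp, ev] at *
    grind
  | plusR1 _ ih =>
    simp only [Multiset.mem_cons, forall_eq_or_imp, exists_eq_or_imp, ev] at *
    grind
  | plusR2 _ ih =>
    simp only [Multiset.mem_cons, forall_eq_or_imp, exists_eq_or_imp, ev] at *
    grind
  | weakL A _ ih =>
    simp only [Multiset.mem_cons, forall_eq_or_imp, exists_eq_or_imp] at *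
    grind
  | weakR A _ ih =>
    simp only [Multiset.mem_cons, forall_eq_or_imp, exists_eq_or_imp] at *
    grind

theorem robust_of_model (v : ℕ → Bool) (J : Finset AForm) (h : ∀ A ∈ J, ev v A = true) :
    robustlyConsistentW J.val := by
  intro Δ hΔ hd
  obtain ⟨B, hB, _⟩ := sound v hd (fun A hA => h A (Multiset.mem_of_le hΔ hA))
  simp at hB

theorem deriv_pq : AWDeriv (p ::ₘ q ::ₘ {AForm.neg (p.awith q)}) 0 := by
  have h1 : AWDeriv (p ::ₘ {q}) {p} := by
    have := AWDeriv.weakL q (AWDeriv.ax p)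
    rwa [show (q ::ₘ {p} : Multiset AForm) = p ::ₘ {q} from Multiset.cons_swap q p 0] at this
  have h2 : AWDeriv (p ::ₘ {q}) {q} := AWDeriv.weakL p (AWDeriv.ax q)
  have h3 : AWDeriv (p ::ₘ {q}) (p.awith q ::ₘ 0) := AWDeriv.withR h1 h2
  have h4 := AWDeriv.negL h3
  rwa [Multiset.cons_swap, show (AForm.neg (p.awith q) ::ₘ {q} : Multiset AForm)
    = q ::ₘ {AForm.neg (p.awith q)} from Multiset.cons_swap _ q 0] at h4

theorem not_taut_of (v : ℕ → Bool) (φ : AForm) (h : ev v φ = false) : ¬ AWDeriv 0 {φ} := by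
  intro hd
  obtain ⟨B, hB, hv⟩ := sound v hd (by simp)
  rw [Multiset.mem_singleton] at hB
  subst hB
  simp [h] at hv

theorem not_contra_of (v : ℕ → Bool) (φ : AForm) (h : ev v φ = true) : ¬ AWDeriv {φ} 0 := by
  intro hd
  obtain ⟨B, hB, hv⟩ := sound v hd (by simpa using h)
  simp at hB

/-- The profile. -/
def prof : Fin 3 → Finset AForm :=
  ![{p, q, p.awith q}, {p, .neg q, .neg (p.awith q)}, {.neg p, q, .neg (p.awith q)}]

/-- The valuations satisfying the members of the profile. -/
def vals : Fin 3 → ℕ → Bool :=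
  ![fun _ => true, fun n => n == 0, fun n => n == 1]

theorem maj_prof : maj 3 Φ prof = {p, q, .neg (p.awith q)} := by decide

/-- ALL with weakening is not safe for the majority rule: the sequent
p, q, ¬(p&q) ⊢ is derivable in ALL W, and on the agenda {p,¬p,q,¬q,p&q,¬(p&q)} there
are an odd number n ≥ 3 of agents and a profile of complete judgment sets, robustly
consistent in ALL W, whose majority outcome contains {p, q, ¬(p&q)} and hence is
ALL W-inconsistent. -/
theorem allW_not_safe :
    AWDeriv (p ::ₘ q ::ₘ {AForm.neg (p.awith q)}) 0 ∧
    (∀ φ ∈ Φ, φ.compl ∈ Φ) ∧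
    (∀ φ ∈ Φ, ¬ AWDeriv 0 {φ} ∧ ¬ AWDeriv {φ} 0) ∧
    ∃ n : ℕ, Odd n ∧ 3 ≤ n ∧
      ∃ J : Fin n → Finset AForm,
        (∀ i, J i ⊆ Φ ∧ completeOn Φ (J i) ∧ robustlyConsistentW (J i).val) ∧
        ({p, q, .neg (p.awith q)} : Finset AForm) ⊆ maj n Φ J ∧
        AWInconsistent (maj n Φ J).val := by
  refine ⟨deriv_pq, by decide, ?_, 3, by decide, le_refl _, prof, ?_, ?_, ?_⟩
  · intro φ hφ
    have hc : (ev (fun _ => true) φ = false ∨ ev (fun _ => false) φ = false) ∧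
        (ev (fun _ => true) φ = true ∨ ev (fun _ => false) φ = true) := by
      revert φ
      decide
    exact ⟨hc.1.elim (not_taut_of _ φ) (not_taut_of _ φ),
      hc.2.elim (not_contra_of _ φ) (not_contra_of _ φ)⟩
  · intro i
    refine ⟨?_, ?_, robust_of_model (vals i) _ ?_⟩
    · revert i; decide
    · unfold completeOn; revert i; decide
    · revert i; decide
  · rw [maj_prof]
  · rw [maj_prof]
    exact deriv_pq

end Stmt14
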